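/- arXiv:2310.16171 — 2 statements merged into one kernel-verified Lean document; each statement's English description precedes it below -/
import Mathlib

section
/- Let λ1, λ2 ≥ 0 and let u, v be grid functions with λ1·max_{i,j}|u_{i,j}| + λ2·max_{i,j}|v_{i,j}| ≤ 1/3. For a grid function ω define L(ω)_{i,j} = (W_{1x}W_{1y}ω)_{i,j} − λ1·(W_{1y}D_x(u∘ω))_{i,j} − λ2·(W_{1x}D_y(v∘ω))_{i,j}. Then L is monotone: if ω, ω' are grid functions with ω_{i,j} ≤ ω'_{i,j} for all i,j, then L(ω)_{i,j} ≤ L(ω')_{i,j} for all i,j. -/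
noncomputable section

/-- Grid functions with periodic indexing. -/
abbrev Grid (Nx Ny : ℕ) : Type := ZMod Nx × ZMod Ny → ℝ

variable {Nx Ny : ℕ}

/-- `(W_{1x}f)_{i,j} = (f_{i-1,j} + 4f_{i,j} + f_{i+1,j})/6` -/
def W1x (f : Grid Nx Ny) : Grid Nx Ny :=
  fun p => (f (p.1 - 1, p.2) + 4 * f p + f (p.1 + 1, p.2)) / 6

/-- `(W_{1y}f)_{i,j} = (f_{i,j-1} + 4f_{i,j} + f_{i,j+1})/6` -/
def W1y (f : Grid Nx Ny) : Grid Nx Ny :=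
  fun p => (f (p.1, p.2 - 1) + 4 * f p + f (p.1, p.2 + 1)) / 6

/-- `(D_x f)_{i,j} = (f_{i+1,j} − f_{i-1,j})/2` -/
def Dx (f : Grid Nx Ny) : Grid Nx Ny :=
  fun p => (f (p.1 + 1, p.2) - f (p.1 - 1, p.2)) / 2

/-- `(D_y f)_{i,j} = (f_{i,j+1} − f_{i,j-1})/2` -/
def Dy (f : Grid Nx Ny) : Grid Nx Ny :=
  fun p => (f (p.1, p.2 + 1) - f (p.1, p.2 - 1)) / 2

/-- Entrywise (Hadamard) product of grid functions. -/
def had (f g : Grid Nx Ny) : Grid Nx Ny := fun p => f p * g p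

/-- Maximum of a grid function over all grid points. -/
def gridSup [NeZero Nx] [NeZero Ny] (f : Grid Nx Ny) : ℝ :=
  Finset.univ.sup' ⟨((0 : ZMod Nx), (0 : ZMod Ny)), Finset.mem_univ _⟩ f

/-- The forward Euler update of the weighted averages:
`L(ω) = W_{1x}W_{1y}ω − λ1·W_{1y}D_x(u∘ω) − λ2·W_{1x}D_y(v∘ω)`. -/
def Lscheme (lam1 lam2 : ℝ) (u v ω : Grid Nx Ny) : Grid Nx Ny :=
  fun p => W1x (W1y ω) p - lam1 * W1y (Dx (had u ω)) p - lam2 * W1x (Dy (had v ω)) p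

/-- Weak monotonicity of the fourth-order compact finite difference scheme with
forward Euler time stepping, under the CFL condition
`λ1·max|u| + λ2·max|v| ≤ 1/3`. -/
theorem weak_monotonicity {Nx Ny : ℕ} [NeZero Nx] [NeZero Ny]
    (hNx : 5 ≤ Nx) (hNy : 5 ≤ Ny)
    (lam1 lam2 : ℝ) (hlam1 : 0 ≤ lam1) (hlam2 : 0 ≤ lam2)
    (u v : Grid Nx Ny)
    (hCFL : lam1 * gridSup (fun p => |u p|) + lam2 * gridSup (fun p => |v p|) ≤ 1 / 3)
    (ω ω' : Grid Nx Ny) (hle : ∀ p, ω p ≤ ω' p) :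
    ∀ p, Lscheme lam1 lam2 u v ω p ≤ Lscheme lam1 lam2 u v ω' p := by
  intro p
  obtain ⟨i, j⟩ := p
  have hu : ∀ q, |u q| ≤ gridSup (fun p => |u p|) := fun q =>
    Finset.le_sup' (fun p => |u p|) (Finset.mem_univ q)
  have hv : ∀ q, |v q| ≤ gridSup (fun p => |v p|) := fun q =>
    Finset.le_sup' (fun p => |v p|) (Finset.mem_univ q)
  have key : ∀ q, ∀ s t : ℝ, |s| ≤ 1 → |t| ≤ 1 →
      0 ≤ (1 / 3 - s * (lam1 * u q) - t * (lam2 * v q)) * (ω' q - ω q) := by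
    intro q s t hs ht
    apply mul_nonneg _ (sub_nonneg.2 (hle q))
    have h1 := mul_le_mul_of_nonneg_left (hu q) hlam1
    have h2 := mul_le_mul_of_nonneg_left (hv q) hlam2
    have h3 : s * (lam1 * u q) ≤ lam1 * |u q| := by
      calc s * (lam1 * u q) ≤ |s * (lam1 * u q)| := le_abs_self _
        _ = |s| * (lam1 * |u q|) := by rw [abs_mul, abs_mul, abs_of_nonneg hlam1]
        _ ≤ _ := mul_le_of_le_one_left (by positivity) hs
    have h4 : t * (lam2 * v q) ≤ lam2 * |v q| := by
      calc t * (lam2 * v q) ≤ |t * (lam2 * v q)| := le_abs_self _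
        _ = |t| * (lam2 * |v q|) := by rw [abs_mul, abs_mul, abs_of_nonneg hlam2]
        _ ≤ _ := mul_le_of_le_one_left (by positivity) ht
    linarith
  have a1 : |(1 : ℝ)| ≤ 1 := by simp
  have a2 : |(-1 : ℝ)| ≤ 1 := by simp
  have a3 : |(0 : ℝ)| ≤ 1 := by simp
  have c1 := key (i + 1, j + 1) 1 1 a1 a1
  have c2 := key (i + 1, j - 1) 1 (-1) a1 a2
  have c3 := key (i - 1, j + 1) (-1) 1 a2 a1
  have c4 := key (i - 1, j - 1) (-1) (-1) a2 a2
  have e1 := key (i + 1, j) 1 0 a1 a3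
  have e2 := key (i - 1, j) (-1) 0 a2 a3
  have e3 := key (i, j + 1) 0 1 a3 a1
  have e4 := key (i, j - 1) 0 (-1) a3 a2
  have m := hle (i, j)
  simp only [Lscheme, W1x, W1y, Dx, Dy, had]
  linarith
end
end

section
/- Let λ1 ≥ 0, reals m ≤ M, and grid functions ω and u⁻ with u⁻_{i,j} ≤ 0 and m ≤ ω_{i,j} ≤ M for all i,j, and λ1·max_{i,j} |u⁻_{i,j}| ≤ 1/24. Write ω̄ = W_{1x}W_{1y}ω. Then for all i,j, both quantities ω̄_{i,j} − 8λ1·(u⁻ω)̂_{i+1/2,j} and ω̄_{i,j} − 8λ1·û⁻_{i+1/2,j}·ω̄_{i+1,j} lie in the interval [m − 8λ1·û⁻_{i+1/2,j}·m, M − 8λ1·û⁻_{i+1/2,j}·M]. -/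
noncomputable section

variable {Nx Ny : ℕ}

/-- x-direction flux: `f̂_{i+1/2,j} = ((W_{1y}f)_{i,j} + (W_{1y}f)_{i+1,j})/2`,
recorded at the integer index `(i,j)`. -/
def fluxX (f : Grid Nx Ny) : Grid Nx Ny :=
  fun p => (W1y f p + W1y f (p.1 + 1, p.2)) / 2

theorem aux_W1y_mono {Nx Ny : ℕ} {f g : Grid Nx Ny} (h : ∀ p, f p ≤ g p) (p) :
    W1y f p ≤ W1y g p := by
  unfold W1y
  linarith [h (p.1, p.2 - 1), h p, h (p.1, p.2 + 1)]

theorem aux_W1x_mono {Nx Ny : ℕ} {f g : Grid Nx Ny} (h : ∀ p, f p ≤ g p) (p) :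
    W1x f p ≤ W1x g p := by
  unfold W1x
  linarith [h (p.1 - 1, p.2), h p, h (p.1 + 1, p.2)]

theorem aux_fluxX_mono {Nx Ny : ℕ} {f g : Grid Nx Ny} (h : ∀ p, f p ≤ g p) (p) :
    fluxX f p ≤ fluxX g p := by
  unfold fluxX
  linarith [aux_W1y_mono h p, aux_W1y_mono h (p.1 + 1, p.2)]

theorem aux_W_const {Nx Ny : ℕ} (c : ℝ) (p) :
    W1x (W1y (fun _ => c : Grid Nx Ny)) p = c := by
  simp only [W1x, W1y]; ring

theorem aux_flux_const {Nx Ny : ℕ} (f : Grid Nx Ny) (c : ℝ) (p) :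
    fluxX (fun q => f q * c) p = fluxX f p * c := by
  simp only [fluxX, W1y]; ring

/-- Monotonicity bounds for the negative-velocity x-direction fluxes: both
`ω̄_{i,j} − 8λ1·(u⁻ω)̂_{i+1/2,j}` and `ω̄_{i,j} − 8λ1·û⁻_{i+1/2,j}·ω̄_{i+1,j}`
lie in `[m − 8λ1·û⁻_{i+1/2,j}·m, M − 8λ1·û⁻_{i+1/2,j}·M]`. -/
theorem flux_bounds_neg {Nx Ny : ℕ} [NeZero Nx] [NeZero Ny]
    (hNx : 5 ≤ Nx) (hNy : 5 ≤ Ny)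
    (lam1 : ℝ) (hlam1 : 0 ≤ lam1) (m M : ℝ) (hmM : m ≤ M)
    (um ω : Grid Nx Ny) (hum : ∀ p, um p ≤ 0) (hω : ∀ p, m ≤ ω p ∧ ω p ≤ M)
    (hCFL : lam1 * gridSup (fun p => |um p|) ≤ 1 / 24) :
    ∀ p : ZMod Nx × ZMod Ny,
      (m - 8 * lam1 * fluxX um p * m
          ≤ W1x (W1y ω) p - 8 * lam1 * fluxX (had um ω) p ∧
        W1x (W1y ω) p - 8 * lam1 * fluxX (had um ω) p
          ≤ M - 8 * lam1 * fluxX um p * M) ∧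
      (m - 8 * lam1 * fluxX um p * m
          ≤ W1x (W1y ω) p - 8 * lam1 * (fluxX um p * W1x (W1y ω) (p.1 + 1, p.2)) ∧
        W1x (W1y ω) p - 8 * lam1 * (fluxX um p * W1x (W1y ω) (p.1 + 1, p.2))
          ≤ M - 8 * lam1 * fluxX um p * M) := by
  intro p
  have hlo : ∀ q, m ≤ W1x (W1y ω) q := fun q => by
    have := aux_W1x_mono (aux_W1y_mono (f := fun _ => m) (g := ω) fun r => (hω r).1) q
    rwa [aux_W_const] at this
  have hhi : ∀ q, W1x (W1y ω) q ≤ M := fun q => by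
    have := aux_W1x_mono (aux_W1y_mono (f := ω) (g := fun _ => M) fun r => (hω r).2) q
    rwa [aux_W_const] at this
  have hf0 : fluxX um p ≤ 0 := by
    have := aux_fluxX_mono (f := um) (g := fun q => um q * 0) (fun q => by simpa using hum q) p
    rwa [aux_flux_const, mul_zero] at this
  have hf1 : fluxX (had um ω) p ≤ fluxX um p * m := by
    rw [← aux_flux_const]
    exact aux_fluxX_mono (fun q => mul_le_mul_of_nonpos_left (hω q).1 (hum q)) p
  have hf2 : fluxX um p * M ≤ fluxX (had um ω) p := by
    rw [← aux_flux_const]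
    exact aux_fluxX_mono (fun q => mul_le_mul_of_nonpos_left (hω q).2 (hum q)) p
  have hg1 := mul_le_mul_of_nonpos_left (hlo (p.1 + 1, p.2)) hf0
  have hg2 := mul_le_mul_of_nonpos_left (hhi (p.1 + 1, p.2)) hf0
  have key1 := mul_le_mul_of_nonneg_left hf1 hlam1
  have key2 := mul_le_mul_of_nonneg_left hf2 hlam1
  have key3 := mul_le_mul_of_nonneg_left hg1 hlam1
  have key4 := mul_le_mul_of_nonneg_left hg2 hlam1
  have a := hlo p
  have b := hhi p
  refine ⟨⟨?_, ?_⟩, ?_, ?_⟩ <;> linarith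
end
end
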